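/- Let G be a finite simple graph, Γ ⊆ Ω(G) nonempty, and let Γ' be a nonempty subfamily of MaxCritIndep(G) such that for every A ∈ Γ' there exists S ∈ Γ with A ⊆ S. If ⋂Γ is a critical set and ⋃Γ' = ⋃Γ, then ⋂Γ' = ⋂Γ. -/

import Mathlib

/-- `S` is an independent set in `G`: no two of its vertices are adjacent. -/
def IndepSet {V : Type*} (G : SimpleGraph V) (S : Set V) : Prop :=
  ∀ ⦃u⦄, u ∈ S → ∀ ⦃v⦄, v ∈ S → ¬G.Adj u v

/-- The independence number `α(G)`. -/
noncomputable def indNum {V : Type*} (G : SimpleGraph V) : ℕ :=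
  sSup {n : ℕ | ∃ S : Set V, IndepSet G S ∧ S.ncard = n}

/-- `Ω(G)`: the family of maximum independent sets of `G`. -/
def maxIndepFam {V : Type*} (G : SimpleGraph V) : Set (Set V) :=
  {S | IndepSet G S ∧ S.ncard = indNum G}

/-- `N(X)`: the neighborhood of a set of vertices. -/
def nbhd {V : Type*} (G : SimpleGraph V) (X : Set V) : Set V :=
  {v | ∃ x ∈ X, G.Adj v x}

/-- `N[X] = N(X) ∪ X`: the closed neighborhood of a set of vertices. -/
def closedNbhd {V : Type*} (G : SimpleGraph V) (X : Set V) : Set V :=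
  nbhd G X ∪ X

/-- The difference `d(X) = |X| - |N(X)|`. -/
noncomputable def diffd {V : Type*} (G : SimpleGraph V) (X : Set V) : ℤ :=
  (X.ncard : ℤ) - ((nbhd G X).ncard : ℤ)

/-- The critical difference `d(G) = max {d(X) : X ⊆ V(G)}`. -/
noncomputable def critDiff {V : Type*} (G : SimpleGraph V) : ℤ :=
  sSup {d : ℤ | ∃ X : Set V, diffd G X = d}

/-- `X` is a critical set if `d(X) = d(G)`. -/
def IsCritical {V : Type*} (G : SimpleGraph V) (X : Set V) : Prop :=
  diffd G X = critDiff G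

/-- `MaxCritIndep(G)`: the family of critical independent sets of maximum cardinality. -/
def maxCritIndepFam {V : Type*} (G : SimpleGraph V) : Set (Set V) :=
  {S | IndepSet G S ∧ IsCritical G S ∧
    ∀ T : Set V, IndepSet G T → IsCritical G T → T.ncard ≤ S.ncard}

/-- The critical independence number `α'(G)`. -/
noncomputable def critIndNum {V : Type*} (G : SimpleGraph V) : ℕ :=
  sSup {n : ℕ | ∃ S : Set V, IndepSet G S ∧ IsCritical G S ∧ S.ncard = n}

/-- `ker(G)`: the intersection of all critical independent sets. -/
def kerSet {V : Type*} (G : SimpleGraph V) : Set V :=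
  ⋂₀ {A : Set V | IndepSet G A ∧ IsCritical G A}

/-- `nucleus(G)`: the intersection of all maximum critical independent sets. -/
def nucleus {V : Type*} (G : SimpleGraph V) : Set V :=
  ⋂₀ maxCritIndepFam G

/-- `diadem(G)`: the union of all maximum critical independent sets. -/
def diadem {V : Type*} (G : SimpleGraph V) : Set V :=
  ⋃₀ maxCritIndepFam G

/-- `core(G)`: the intersection of all maximum independent sets. -/
def coreSet {V : Type*} (G : SimpleGraph V) : Set V :=
  ⋂₀ maxIndepFam G

/-- `corona(G)`: the union of all maximum independent sets. -/
def coronaSet {V : Type*} (G : SimpleGraph V) : Set V :=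
  ⋃₀ maxIndepFam G

/-- A matching in `G`: a set of pairwise non-incident edges of `G`. -/
def IsMatchingSet {V : Type*} (G : SimpleGraph V) (M : Set (Sym2 V)) : Prop :=
  M ⊆ G.edgeSet ∧ M.Pairwise fun e f => ∀ v, v ∈ e → v ∉ f

/-- The matching number `μ(G)`. -/
noncomputable def matchNum {V : Type*} (G : SimpleGraph V) : ℕ :=
  sSup {n : ℕ | ∃ M : Set (Sym2 V), IsMatchingSet G M ∧ M.ncard = n}

/-- `G` is a König-Egerváry graph if `α(G) + μ(G) = |V(G)|`. -/
def IsKonigEgervary {V : Type*} (G : SimpleGraph V) : Prop :=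
  indNum G + matchNum G = Nat.card V

/-- `Γ` is a König-Egerváry collection: a family of independent sets with
`|⋂Γ| + |⋃Γ| = 2α(G)`. -/
def IsKECollection {V : Type*} (G : SimpleGraph V) (Γ : Set (Set V)) : Prop :=
  (∀ S ∈ Γ, IndepSet G S) ∧ (⋂₀ Γ).ncard + (⋃₀ Γ).ncard = 2 * indNum G

theorem IndepSet.mono {V : Type*} {G : SimpleGraph V} {S T : Set V} (hT : IndepSet G T)
    (h : S ⊆ T) : IndepSet G S :=
  fun _ hu _ hv => hT (h hu) (h hv)

theorem IndepSet.ncard_le_indNum {V : Type*} [Finite V] {G : SimpleGraph V} {S : Set V}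
    (hS : IndepSet G S) : S.ncard ≤ indNum G := by
  refine le_csSup ⟨Nat.card V, ?_⟩ ⟨S, hS, rfl⟩
  rintro _ ⟨T, -, rfl⟩
  exact Set.ncard_le_card T

theorem diffd_le_critDiff {V : Type*} [Finite V] (G : SimpleGraph V) (X : Set V) :
    diffd G X ≤ critDiff G :=
  le_csSup (Set.finite_range (diffd G)).bddAbove ⟨X, rfl⟩

theorem nbhd_union {V : Type*} (G : SimpleGraph V) (X Y : Set V) :
    nbhd G (X ∪ Y) = nbhd G X ∪ nbhd G Y := by
  ext v
  simp only [nbhd, Set.mem_union, Set.mem_ofPred_eq, or_and_right, exists_or]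

theorem nbhd_inter_subset {V : Type*} (G : SimpleGraph V) (X Y : Set V) :
    nbhd G (X ∩ Y) ⊆ nbhd G X ∩ nbhd G Y :=
  fun _ ⟨x, hx, h⟩ => ⟨⟨x, hx.1, h⟩, ⟨x, hx.2, h⟩⟩

/-- The difference function is supermodular. -/
theorem diffd_add_diffd_le {V : Type*} [Finite V] (G : SimpleGraph V) (X Y : Set V) :
    diffd G X + diffd G Y ≤ diffd G (X ∪ Y) + diffd G (X ∩ Y) := by
  have h₁ := Set.ncard_union_add_ncard_inter X Y
  have h₂ := Set.ncard_union_add_ncard_inter (nbhd G X) (nbhd G Y)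
  have h₃ := Set.ncard_le_ncard (nbhd_inter_subset G X Y)
  simp only [diffd, nbhd_union]
  omega

theorem IsCritical.union {V : Type*} [Finite V] {G : SimpleGraph V} {X Y : Set V}
    (hX : IsCritical G X) (hY : IsCritical G Y) : IsCritical G (X ∪ Y) := by
  have h₁ := diffd_add_diffd_le G X Y
  have h₂ := diffd_le_critDiff G (X ∪ Y)
  have h₃ := diffd_le_critDiff G (X ∩ Y)
  unfold IsCritical at *
  omega

/-- A critical set whose union with a maximum critical independent set `A` is independent
is contained in `A`. -/
theorem IsCritical.subset_of_mem_maxCritIndepFam {V : Type*} [Finite V] {G : SimpleGraph V}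
    {A X : Set V} (hX : IsCritical G X) (hA : A ∈ maxCritIndepFam G)
    (h : IndepSet G (A ∪ X)) : X ⊆ A := by
  have heq : A = A ∪ X :=
    Set.eq_of_subset_of_ncard_le Set.subset_union_left (hA.2.2 _ h (hA.2.1.union hX))
  exact Set.union_eq_left.mp heq.symm

/-- A maximum independent set contains every vertex without neighbors in it. -/
theorem mem_of_mem_maxIndepFam {V : Type*} [Finite V] {G : SimpleGraph V} {S : Set V} {v : V}
    (hS : S ∈ maxIndepFam G) (hv : ∀ u ∈ S, ¬G.Adj v u) : v ∈ S := by
  by_contra hvS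
  have hind : IndepSet G (insert v S) := by
    rintro a (rfl | ha) b (rfl | hb)
    · exact G.irrefl
    · exact hv b hb
    · exact fun h => hv a ha h.symm
    · exact hS.1 ha hb
  have hcard := hind.ncard_le_indNum
  rw [Set.ncard_insert_of_notMem hvS, hS.2] at hcard
  omega

/-- If `Γ ⊆ Ω(G)` is nonempty, `Γ'` is a nonempty subfamily of
`MaxCritIndep(G)` such that every `A ∈ Γ'` is contained in some `S ∈ Γ`, `⋂Γ` is a
critical set, and `⋃Γ' = ⋃Γ`, then `⋂Γ' = ⋂Γ`. -/
theorem stmt9 {V : Type*} [Fintype V] (G : SimpleGraph V)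
    (Γ Γ' : Set (Set V)) (hne : Γ.Nonempty) (hΓ : Γ ⊆ maxIndepFam G)
    (hne' : Γ'.Nonempty) (hΓ' : Γ' ⊆ maxCritIndepFam G)
    (hcov : ∀ A ∈ Γ', ∃ S ∈ Γ, A ⊆ S)
    (hcrit : IsCritical G (⋂₀ Γ))
    (hU : ⋃₀ Γ' = ⋃₀ Γ) :
    ⋂₀ Γ' = ⋂₀ Γ := by
  apply Set.Subset.antisymm
  · intro v hv S hS
    refine mem_of_mem_maxIndepFam (hΓ hS) fun u hu => ?_
    obtain ⟨A, hA, huA⟩ : u ∈ ⋃₀ Γ' := hU ▸ Set.mem_sUnion_of_mem hu hS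
    exact (hΓ' hA).1 (hv A hA) huA
  · refine Set.subset_sInter fun A hA => ?_
    obtain ⟨S, hS, hAS⟩ := hcov A hA
    exact hcrit.subset_of_mem_maxCritIndepFam (hΓ' hA)
      ((hΓ hS).1.mono (Set.union_subset hAS (Set.sInter_subset_of_mem hS)))
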